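/- Let F* ⊣ F_* : 𝒜 → ℬ be a morphism of locally finitely presentable categories. Then the comma category F_*↓ℬ is locally finitely presentable, and its finitely presented objects are exactly the objects of 𝒢_{F_*}: arrows f : F_*(M) → B with M finitely presented in 𝒜 and f a pushout of a morphism between finitely presented objects of ℬ. -/

import Mathlib

open CategoryTheory Limits Opposite

universe w v u

section Defs

variable {𝒞 : Type u} [Category.{v} 𝒞]

/-- An object `K` is finitely presented if `Hom(K, -)` preserves filtered colimits. -/
def IsFinPres (K : 𝒞) : Prop :=
  ∀ (J : Type v) (_ : SmallCategory J) (_ : IsFiltered J),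
    Nonempty (PreservesColimitsOfShape J (coyoneda.obj (op K)))

/-- A category is locally finitely presentable if it is cocomplete and admits an essentially
small family of finitely presented objects such that every object is a filtered colimit of
objects of this family. -/
class IsLFP (𝒞 : Type u) [Category.{v} 𝒞] extends HasColimits 𝒞 : Prop where
  exists_gen : ∃ S : Set 𝒞, Small.{v} S ∧ (∀ K ∈ S, IsFinPres K) ∧
    ∀ X : 𝒞, ∃ (J : Type v) (_ : SmallCategory J) (_ : IsFiltered J)
      (D : J ⥤ 𝒞) (c : Cocone D) (_ : Nonempty (IsColimit c)),
      c.pt = X ∧ ∀ j, D.obj j ∈ S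

/-- `l : X ⟶ Y` belongs to the coslice generator `𝒢_X`: it is a pushout of a morphism
between finitely presented objects along a map into `X`. -/
def InGen {X Y : 𝒞} (l : X ⟶ Y) : Prop :=
  ∃ (K K' : 𝒞) (_ : IsFinPres K) (_ : IsFinPres K') (k : K ⟶ K') (a : K ⟶ X)
    (c : K' ⟶ Y), IsPushout a k l c

end Defs
open Cardinal
attribute [local instance] fact_isRegular_aleph0
attribute [local simp] pushout.inl_desc pushout.inl_desc_assoc pushout.inr_desc
  pushout.inr_desc_assoc coprod.inl_desc coprod.inl_desc_assoc coprod.inr_desc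
  coprod.inr_desc_assoc coequalizer.π_desc coequalizer.π_desc_assoc

section FinPres

variable {𝒞 : Type u} [Category.{v} 𝒞]

lemma isFinPres_iff (K : 𝒞) : IsFinPres K ↔ IsFinitelyPresentable.{v} K := by
  rw [isFinitelyPresentable_iff_preservesFilteredColimitsOfSize]
  refine ⟨fun h ↦ ⟨fun J _ _ ↦ (h J _ inferInstance).some⟩, fun h J _ _ ↦ ⟨inferInstance⟩⟩

lemma IsFinPres.of_isColimit {J : Type} [SmallCategory J] [FinCategory J] {D : J ⥤ 𝒞}
    {c : Cocone D} (hc : IsColimit c) (h : ∀ j, IsFinPres (D.obj j)) : IsFinPres c.pt := by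
  simp only [isFinPres_iff] at h ⊢
  exact isCardinalPresentable_of_isColimit' c hc (ℵ₀ : Cardinal.{v})
    (by simp only [hasCardinalLT_aleph0_iff]; infer_instance)

lemma IsFinPres.of_isPushout {X Y Z W : 𝒞} {f : X ⟶ Y} {g : X ⟶ Z} {h : Y ⟶ W} {i : Z ⟶ W}
    (sq : IsPushout f g h i) (hX : IsFinPres X) (hY : IsFinPres Y) (hZ : IsFinPres Z) :
    IsFinPres W :=
  IsFinPres.of_isColimit sq.isColimit (by rintro (_ | _ | _) <;> assumption)

lemma IsFinPres.coprod {X Y : 𝒞} [HasBinaryCoproduct X Y] (hX : IsFinPres X)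
    (hY : IsFinPres Y) : IsFinPres (X ⨿ Y) :=
  IsFinPres.of_isColimit (colimit.isColimit (pair X Y)) (by rintro (_ | _) <;> assumption)

lemma IsFinPres.initial [HasInitial 𝒞] : IsFinPres (⊥_ 𝒞) :=
  IsFinPres.of_isColimit (colimit.isColimit (Functor.empty.{0} 𝒞)) (by rintro ⟨⟨⟩⟩)

lemma IsFinPres.of_iso {X Y : 𝒞} (e : X ≅ Y) (hX : IsFinPres X) : IsFinPres Y := by
  rw [isFinPres_iff] at *
  exact isCardinalPresentable_of_iso e ℵ₀

variable (𝒞) in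
lemma IsLFP.exists_small_generator [IsLFP 𝒞] :
    ∃ (P : ObjectProperty 𝒞) (_ : ObjectProperty.Small.{v} P),
      P.IsCardinalFilteredGenerator (ℵ₀ : Cardinal.{v}) := by
  obtain ⟨S, hS, h, h'⟩ := IsLFP.exists_gen (𝒞 := 𝒞)
  refine ⟨fun X ↦ X ∈ S, hS, fun X hX ↦ (isFinPres_iff X).1 (h X hX), fun X ↦ ?_⟩
  obtain ⟨J, _, _, D, c, ⟨hc⟩, rfl, hD⟩ := h' X
  exact ⟨J, inferInstance, by rw [isCardinalFiltered_aleph0_iff]; infer_instance,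
    ⟨{ diag := D, ι := c.ι, isColimit := hc, prop_diag_obj := hD }⟩⟩

lemma IsLFP.of_isCardinalLocallyPresentable
    [IsCardinalLocallyPresentable 𝒞 (ℵ₀ : Cardinal.{v})] : IsLFP 𝒞 where
  exists_gen := by
    obtain ⟨P, hP, h⟩ :=
      HasCardinalFilteredGenerator.exists_small_generator 𝒞 (ℵ₀ : Cardinal.{v})
    refine ⟨{X | P X}, hP, fun X hX ↦ (isFinPres_iff X).2 (h.le_isCardinalPresentable X hX),
      fun X ↦ ?_⟩
    obtain ⟨J, _, _, ⟨p⟩⟩ := h.exists_colimitsOfShape X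
    exact ⟨J, inferInstance, isFiltered_of_isCardinalFiltered J (ℵ₀ : Cardinal.{v}), p.diag,
      p.cocone, ⟨p.isColimit⟩, rfl, p.prop_diag_obj⟩

/-- Cobase change along a fixed morphism commutes with filtered colimits: the pushouts of
`k : K ⟶ K'` along a natural family `K ⟶ D.obj j` have colimit the pushout of `k` along
`K ⟶ colim D`. -/
lemma nonempty_isColimit_pushout {J : Type v} [SmallCategory J] [IsFiltered J]
    [HasPushouts 𝒞] {D : J ⥤ 𝒞} {c : Cocone D} (hc : IsColimit c) {K K' Y : 𝒞} (k : K ⟶ K')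
    (s : (Functor.const J).obj K ⟶ D) {a : K ⟶ c.pt} (ha : ∀ j, s.app j ≫ c.ι.app j = a)
    {l : c.pt ⟶ Y} {b : K' ⟶ Y} (sq : IsPushout a k l b) :
    ∃ (E : J ⥤ 𝒞) (p : D ⟶ E) (q : (Functor.const J).obj K' ⟶ E) (ι : E ⟶ (Functor.const J).obj Y)
      (_ : ∀ j, IsPushout (s.app j) k (p.app j) (q.app j))
      (_ : ∀ j, p.app j ≫ ι.app j = c.ι.app j ≫ l) (_ : ∀ j, q.app j ≫ ι.app j = b),
      Nonempty (IsColimit (Cocone.mk Y ι)) := by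
  have hs {i j : J} (f : i ⟶ j) : s.app i ≫ D.map f = s.app j := by
    simpa using (s.naturality f).symm
  let E : J ⥤ 𝒞 :=
    { obj := fun j ↦ pushout (s.app j) k
      map := fun {i j} f ↦ pushout.desc (D.map f ≫ pushout.inl _ _) (pushout.inr _ _)
        (by rw [reassoc_of% hs f, pushout.condition])
      map_id := fun j ↦ by apply pushout.hom_ext <;> simp
      map_comp := fun f g ↦ by apply pushout.hom_ext <;> simp }
  have w (j : J) : s.app j ≫ c.ι.app j ≫ l = k ≫ b := by
    rw [reassoc_of% ha j, sq.w]
  let ι : E ⟶ (Functor.const J).obj Y :=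
    { app := fun j ↦ pushout.desc (c.ι.app j ≫ l) b (w j)
      naturality := fun i j f ↦ by apply pushout.hom_ext <;> simp [E] }
  refine ⟨E, { app := fun j ↦ pushout.inl _ _, naturality := by simp [E] },
    { app := fun j ↦ pushout.inr _ _, naturality := by simp [E] }, ι,
    fun j ↦ IsPushout.of_hasPushout _ _, by simp [ι], by simp [ι], ⟨?_⟩⟩
  have hE {i j : J} (f : i ⟶ j) : pushout.inl _ _ ≫ E.map f = D.map f ≫ pushout.inl _ _ := by
    simp [E]
  have hE' {i j : J} (f : i ⟶ j) : pushout.inr _ _ ≫ E.map f = pushout.inr _ _ := by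
    simp [E]
  have inr_eq (t : Cocone E) (i j : J) :
      pushout.inr _ _ ≫ t.ι.app i = pushout.inr _ _ ≫ t.ι.app j := by
    rw [← t.w (IsFiltered.leftToMax i j), ← t.w (IsFiltered.rightToMax i j),
      reassoc_of% hE', reassoc_of% hE']
  let j₀ : J := IsFiltered.nonempty.some
  let t₁ (t : Cocone E) : Cocone D :=
    { pt := t.pt
      ι := { app := fun j ↦ pushout.inl _ _ ≫ t.ι.app j
             naturality := fun i j f ↦ by
              rw [← reassoc_of% hE, t.w]; simp } }
  have w' (t : Cocone E) : a ≫ hc.desc (t₁ t) = k ≫ pushout.inr _ _ ≫ t.ι.app j₀ := by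
    rw [← ha j₀, Category.assoc, hc.fac]
    simp only [t₁]
    rw [pushout.condition_assoc]
  refine
    { desc := fun t ↦ sq.desc (hc.desc (t₁ t)) (pushout.inr _ _ ≫ t.ι.app j₀) (w' t)
      fac := fun t j ↦ ?_
      uniq := fun t m hm ↦ ?_ }
  · apply pushout.hom_ext
    · simp [ι, t₁]
    · simp [ι, inr_eq t j j₀]
  · apply sq.hom_ext
    · apply hc.hom_ext
      intro j
      simp [t₁, ← hm, ι]
    · simp [← hm, ι]

/-- If `l : X ⟶ Y` lies in the coslice generator, any map from a finitely presented object
to `Y` factors through the codomain of some finitely presented morphism of which `l` is a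
pushout. -/
lemma InGen.exists_factorization [IsLFP 𝒞] {X Y : 𝒞} {l : X ⟶ Y} (hl : InGen l) {L : 𝒞}
    (hL : IsFinPres L) (b : L ⟶ Y) :
    ∃ (K K' : 𝒞) (_ : IsFinPres K) (_ : IsFinPres K') (k : K ⟶ K') (a : K ⟶ X)
      (c : K' ⟶ Y) (_ : IsPushout a k l c) (b' : L ⟶ K'), b' ≫ c = b := by
  obtain ⟨K, K', hK, hK', k, a, c, sq⟩ := hl
  obtain ⟨P, _, hP⟩ := IsLFP.exists_small_generator 𝒞
  obtain ⟨J, _, _, ⟨p⟩⟩ := hP.exists_colimitsOfShape X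
  have := isFiltered_of_isCardinalFiltered J (ℵ₀ : Cardinal.{v})
  have := (isFinPres_iff K).1 hK
  have := (isFinPres_iff L).1 hL
  obtain ⟨i, a', rfl⟩ := IsFinitelyPresentable.exists_hom_of_isColimit p.isColimit a
  let s : (Functor.const (Under i)).obj K ⟶ Under.forget i ⋙ p.diag :=
    { app := fun j ↦ a' ≫ p.diag.map j.hom
      naturality := fun j j' f ↦ by simp [← Functor.map_comp] }
  obtain ⟨E, q, r, ι, hE, h₁, h₂, ⟨hι⟩⟩ := nonempty_isColimit_pushout
    ((Functor.Final.isColimitWhiskerEquiv (Under.forget i) p.cocone).symm p.isColimit) k s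
    (a := a' ≫ p.ι.app i) (fun j ↦ by simp [s]) sq
  obtain ⟨j, b', rfl⟩ := IsFinitelyPresentable.exists_hom_of_isColimit hι b
  have hj : IsFinPres (p.diag.obj j.right) :=
    (isFinPres_iff _).2 (hP.le_isCardinalPresentable _ (p.prop_diag_obj _))
  refine ⟨_, _, hj, IsFinPres.of_isPushout (hE j) hK hj hK', q.app j, p.ι.app j.right,
    ι.app j, ?_, b', rfl⟩
  refine IsPushout.of_left (h₁₁ := s.app j) (v₁₁ := k) (h₂₁ := r.app j) ?_ (h₁ j).symm (hE j)
  have hs : s.app j ≫ p.ι.app j.right = a' ≫ p.ι.app i := by simp [s]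
  rw [hs, h₂ j]
  exact sq

lemma InGen.id [HasInitial 𝒞] (X : 𝒞) : InGen (𝟙 X) :=
  ⟨⊥_ 𝒞, ⊥_ 𝒞, .initial, .initial, 𝟙 _, initial.to X, initial.to X, IsPushout.of_vert_isIso ⟨by simp⟩⟩

lemma InGen.of_isPushout {X Y Z W : 𝒞} {f : X ⟶ Y} {g : X ⟶ Z} {h : Y ⟶ W} {i : Z ⟶ W}
    (hg : InGen g) (sq : IsPushout f g h i) : InGen h := by
  obtain ⟨K, K', hK, hK', k, a, c, sq'⟩ := hg
  exact ⟨K, K', hK, hK', k, a ≫ f, c ≫ i, sq'.paste_horiz sq⟩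

lemma InGen.comp [IsLFP 𝒞] {X Y Z : 𝒞} {f : X ⟶ Y} {g : Y ⟶ Z} (hf : InGen f)
    (hg : InGen g) : InGen (f ≫ g) := by
  obtain ⟨L, L', hL, hL', l, b, d, sq⟩ := hg
  obtain ⟨K, K', hK, hK', k, a, c, sq', b', rfl⟩ := hf.exists_factorization hL b
  have hP := IsPushout.of_hasPushout b' l
  have hP' := IsPushout.of_left (h₁₂ := c) (h₂₂ := hP.desc (c ≫ g) d (by simpa using sq.w))
    (v₁₃ := g) (by simpa using sq) (by simp) hP
  exact ⟨K, _, hK, IsFinPres.of_isPushout hP hL hK' hL', _, a, _, sq'.paste_vert hP'⟩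

lemma InGen.comp_coequalizer [IsLFP 𝒞] {X Y L : 𝒞} {f : X ⟶ Y} (hf : InGen f)
    (hL : IsFinPres L) (b₁ b₂ : L ⟶ Y) : InGen (f ≫ coequalizer.π b₁ b₂) := by
  have := hasFiniteColimits_of_hasColimits 𝒞
  refine hf.comp ⟨L ⨿ L, L, hL.coprod hL, hL, coprod.desc (𝟙 L) (𝟙 L), coprod.desc b₁ b₂,
    b₁ ≫ coequalizer.π b₁ b₂, ⟨⟨?_⟩, ⟨?_⟩⟩⟩
  · ext
    · simp
    · simpa using (coequalizer.condition b₁ b₂).symm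
  · have h₁ (s : PushoutCocone (coprod.desc b₁ b₂) (coprod.desc (𝟙 L) (𝟙 L))) :
        b₁ ≫ s.inl = s.inr := by
      simpa using coprod.inl ≫= s.condition
    have h₂ (s : PushoutCocone (coprod.desc b₁ b₂) (coprod.desc (𝟙 L) (𝟙 L))) :
        b₂ ≫ s.inl = s.inr := by
      simpa using coprod.inr ≫= s.condition
    refine PushoutCocone.IsColimit.mk _
      (fun s ↦ coequalizer.desc s.inl ((h₁ s).trans (h₂ s).symm)) (fun s ↦ by simp)
      (fun s ↦ by simp [h₁]) (fun s m hm _ ↦ by ext; simpa using hm)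

end FinPres

section CommaColimits

variable {𝒜 : Type u} {ℬ : Type w} [Category.{v} 𝒜] [Category.{v} ℬ] (F : 𝒜 ⥤ ℬ)

lemma hasColimit_comma_id {J : Type v} [SmallCategory J] [HasColimits 𝒜] [HasColimits ℬ]
    (D : J ⥤ Comma F (𝟭 ℬ)) : HasColimit D := by
  let DA : J ⥤ 𝒜 := D ⋙ Comma.fst F (𝟭 ℬ)
  let DB : J ⥤ ℬ := D ⋙ Comma.snd F (𝟭 ℬ)
  let a : colimit (DA ⋙ F) ⟶ F.obj (colimit DA) := colimit.post DA F
  let n : DA ⋙ F ⟶ DB := { app := fun j ↦ (D.obj j).hom, naturality := fun i j f ↦ (D.map f).w }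
  have w (j : J) : F.map (colimit.ι DA j) ≫ pushout.inl a (colimMap n) =
      n.app j ≫ colimit.ι DB j ≫ pushout.inr a (colimMap n) := by
    rw [← colimit.ι_post_assoc, pushout.condition, ι_colimMap_assoc]
  let t : Cocone D :=
    { pt := { left := colimit DA, right := pushout a (colimMap n), hom := pushout.inl _ _ }
      ι :=
        { app := fun j ↦
            { left := colimit.ι DA j
              right := colimit.ι DB j ≫ pushout.inr _ _
              w := w j }
          naturality := fun i j f ↦ by
            ext
            · exact (colimit.w DA f).trans (Category.comp_id _).symm
            · exact (colimit.w_assoc DB f _).trans (Category.comp_id _).symm } }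
  have wd (s : Cocone D) :
      a ≫ F.map (colimit.desc DA ((Comma.fst F (𝟭 ℬ)).mapCocone s)) ≫ s.pt.hom =
      colimMap n ≫ colimit.desc DB ((Comma.snd F (𝟭 ℬ)).mapCocone s) := by
    apply colimit.hom_ext
    intro j
    simp [a, ← Functor.map_comp_assoc, n]
  refine ⟨t, { desc := fun s ↦
    { left := colimit.desc DA ((Comma.fst F (𝟭 ℬ)).mapCocone s)
      right := pushout.desc (F.map (colimit.desc DA ((Comma.fst F (𝟭 ℬ)).mapCocone s)) ≫ s.pt.hom)
        (colimit.desc DB ((Comma.snd F (𝟭 ℬ)).mapCocone s)) (wd s)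
      w := by simp [t] }, fac := fun s j ↦ ?_, uniq := fun s m hm ↦ ?_ }⟩
  · ext <;> simp [t]
  · have h₁ : m.left = colimit.desc DA ((Comma.fst F (𝟭 ℬ)).mapCocone s) := by
      apply colimit.hom_ext
      intro j
      simp [← hm, t]
    apply Comma.hom_ext
    · exact h₁
    · apply pushout.hom_ext
      · have : F.map m.left ≫ s.pt.hom = pushout.inl _ _ ≫ m.right := m.w
        simp [← this, h₁]
      · apply colimit.hom_ext
        intro j
        simp [t, ← hm]

lemma hasColimits_comma_id [HasColimits 𝒜] [HasColimits ℬ] : HasColimits (Comma F (𝟭 ℬ)) :=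
  ⟨fun _ _ ↦ ⟨fun D ↦ hasColimit_comma_id F D⟩⟩

variable {F}

/-- A commutative square in `F ↓ ℬ` is a pushout as soon as its left component is one and its
right component has the corresponding universal property relative to `F`. -/
lemma isPushout_comma_id {X Y Z W : Comma F (𝟭 ℬ)} {f : X ⟶ Y} {g : X ⟶ Z} {h : Y ⟶ W}
    {i : Z ⟶ W} (hl : IsPushout f.left g.left h.left i.left)
    (hr : f.right ≫ h.right = g.right ≫ i.right)
    (desc : ∀ {N : ℬ} (b : F.obj W.left ⟶ N) (y : Y.right ⟶ N) (z : Z.right ⟶ N),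
      f.right ≫ y = g.right ≫ z → F.map h.left ≫ b = Y.hom ≫ y →
      F.map i.left ≫ b = Z.hom ≫ z →
      ∃ d : W.right ⟶ N, W.hom ≫ d = b ∧ h.right ≫ d = y ∧ i.right ≫ d = z)
    (hom_ext : ∀ {N : ℬ} (d d' : W.right ⟶ N), W.hom ≫ d = W.hom ≫ d' →
      h.right ≫ d = h.right ≫ d' → i.right ≫ d = i.right ≫ d' → d = d') :
    IsPushout f g h i := by
  have key (s : PushoutCocone f g) : ∃ d : W ⟶ s.pt, h ≫ d = s.inl ∧ i ≫ d = s.inr := by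
    have c₁ := congr_arg CommaMorphism.left s.condition
    have c₂ := congr_arg CommaMorphism.right s.condition
    have w₁ : F.map s.inl.left ≫ s.pt.hom = Y.hom ≫ s.inl.right := s.inl.w
    have w₂ : F.map s.inr.left ≫ s.pt.hom = Z.hom ≫ s.inr.right := s.inr.w
    obtain ⟨d, h₁, h₂, h₃⟩ := desc (F.map (hl.desc s.inl.left s.inr.left c₁) ≫ s.pt.hom)
      s.inl.right s.inr.right c₂ (by rw [← F.map_comp_assoc, hl.inl_desc, w₁])
      (by rw [← F.map_comp_assoc, hl.inr_desc, w₂])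
    exact ⟨{ left := hl.desc s.inl.left s.inr.left c₁, right := d, w := by simpa using h₁.symm },
      by ext <;> simp [h₂], by ext <;> simp [h₃]⟩
  choose d hd hd' using key
  refine ⟨⟨by ext <;> simp [hl.w, hr]⟩, ⟨PushoutCocone.IsColimit.mk _ d hd hd' ?_⟩⟩
  intro s m hm hm'
  have e₁ : h ≫ m = h ≫ d s := by rw [hm, hd]
  have e₂ : i ≫ m = i ≫ d s := by rw [hm', hd']
  have e₃ : m.left = (d s).left :=
    hl.hom_ext (congr_arg CommaMorphism.left e₁) (congr_arg CommaMorphism.left e₂)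
  ext
  · exact e₃
  · refine hom_ext _ _ ?_ (congr_arg CommaMorphism.right e₁) (congr_arg CommaMorphism.right e₂)
    have w₁ : F.map m.left ≫ s.pt.hom = W.hom ≫ m.right := m.w
    have w₂ : F.map (d s).left ≫ s.pt.hom = W.hom ≫ (d s).right := (d s).w
    rw [← w₁, ← w₂, e₃]

end CommaColimits

section ClosedUnderFiniteColimits

variable {𝒞 : Type u} [Category.{v} 𝒞]

lemma nonempty_finCategory_of_finite_arrow (J : Type v) [SmallCategory J] [Finite (Arrow J)] :
    Nonempty (FinCategory J) := by
  have : Finite J := Finite.of_injective (fun j ↦ Arrow.mk (𝟙 j))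
    (fun _ _ h ↦ congr_arg Comma.left h)
  have (i j : J) : Finite (i ⟶ j) := Finite.of_injective (fun f ↦ Arrow.mk f)
    (fun _ _ h ↦ Arrow.mk_injective _ _ h)
  have := Fintype.ofFinite J
  have (i j : J) := Fintype.ofFinite (i ⟶ j)
  exact ⟨{}⟩

/-- A property of objects that holds for an initial object and is stable under pushouts is
stable under finite colimits. -/
lemma isClosedUnderColimitsOfShape_of_initial_of_pushout [HasFiniteColimits 𝒞]
    (P : ObjectProperty 𝒞) [P.IsClosedUnderIsomorphisms] {X₀ : 𝒞} (hX₀ : IsInitial X₀)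
    (h₀ : P X₀) (h : ∀ {X Y Z : 𝒞} (f : X ⟶ Y) (g : X ⟶ Z), P X → P Y → P Z →
      ∃ (W : 𝒞) (h : Y ⟶ W) (i : Z ⟶ W), IsPushout f g h i ∧ P W)
    (J : Type v) [SmallCategory J] [Finite (Arrow J)] : P.IsClosedUnderColimitsOfShape J := by
  have : P.IsClosedUnderColimitsOfShape (Discrete.{0} PEmpty) := ⟨by
    rintro X ⟨p⟩
    have hX : IsInitial X :=
      (IsColimit.equivOfNatIsoOfIso p.diag.uniqueFromEmpty _ _
        (by exact Cocone.ext (Iso.refl _) (by rintro ⟨⟨⟩⟩))).1 p.isColimit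
    exact P.prop_of_iso (hX₀.uniqueUpToIso hX) h₀⟩
  have : P.IsClosedUnderColimitsOfShape WalkingSpan := ⟨by
    rintro X ⟨p⟩
    obtain ⟨W, i, j, sq, hW⟩ := h (p.diag.map WalkingSpan.Hom.fst)
      (p.diag.map WalkingSpan.Hom.snd) (p.prop_diag_obj _) (p.prop_diag_obj _)
      (p.prop_diag_obj _)
    have hp := (IsColimit.precomposeInvEquiv (diagramIsoSpan p.diag) p.cocone).symm p.isColimit
    exact P.prop_of_iso (sq.isColimit.coconePointUniqueUpToIso hp) hW⟩
  have : HasInitial P.FullSubcategory := hasColimitsOfShape_of_closedUnderColimits _ P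
  have : HasPushouts P.FullSubcategory := hasColimitsOfShape_of_closedUnderColimits _ P
  have : HasFiniteColimits P.FullSubcategory := hasFiniteColimits_of_hasInitial_and_pushouts
  have := preservesFiniteColimits_of_preservesInitial_and_pushouts P.ι
  have := (nonempty_finCategory_of_finite_arrow J).some
  exact P.isClosedUnderColimitsOfShape_of_preservesColimitsOfShape_ι J

end ClosedUnderFiniteColimits

section CommaFinPres

variable {𝒜 : Type u} {ℬ : Type w} [Category.{v} 𝒜] [Category.{v} ℬ] (F : 𝒜 ⥤ ℬ)

/-- The object of `F ↓ ℬ` corepresenting `X ↦ (M ⟶ X.left)`. -/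
abbrev commaIdLeft (M : 𝒜) : Comma F (𝟭 ℬ) where
  left := M
  right := F.obj M
  hom := 𝟙 _

/-- The object of `F ↓ ℬ` corepresenting `X ↦ (K ⟶ X.right)`. -/
noncomputable abbrev commaIdRight [HasInitial 𝒜] [HasBinaryCoproducts ℬ] (K : ℬ) :
    Comma F (𝟭 ℬ) where
  left := ⊥_ 𝒜
  right := F.obj (⊥_ 𝒜) ⨿ K
  hom := coprod.inl

variable {F}

/-- The morphism out of `commaIdLeft F M` given by a morphism out of `M`. -/
@[simps]
def commaIdLeftDesc {M : 𝒜} {X : Comma F (𝟭 ℬ)} (f : M ⟶ X.left) : commaIdLeft F M ⟶ X where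
  left := f
  right := F.map f ≫ X.hom
  w := (Category.id_comp _).symm

/-- The morphism out of `commaIdRight F K` given by a morphism out of `K`. -/
@[simps]
noncomputable def commaIdRightDesc [HasInitial 𝒜] [HasBinaryCoproducts ℬ] {K : ℬ}
    {X : Comma F (𝟭 ℬ)} (f : K ⟶ X.right) : commaIdRight F K ⟶ X where
  left := initial.to _
  right := coprod.desc (F.map (initial.to _) ≫ X.hom) f
  w := (coprod.inl_desc _ _).symm

lemma commaIdLeft_hom_ext {M : 𝒜} {X : Comma F (𝟭 ℬ)} {f g : commaIdLeft F M ⟶ X}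
    (h : f.left = g.left) : f = g := by
  have hf : F.map f.left ≫ X.hom = 𝟙 _ ≫ f.right := f.w
  have hg : F.map g.left ≫ X.hom = 𝟙 _ ≫ g.right := g.w
  refine Comma.hom_ext _ _ h ?_
  rw [← Category.id_comp f.right, ← hf, h, hg, Category.id_comp]

lemma commaIdRight_hom_ext [HasInitial 𝒜] [HasBinaryCoproducts ℬ] {K : ℬ}
    {X : Comma F (𝟭 ℬ)} {f g : commaIdRight F K ⟶ X}
    (h : coprod.inr ≫ f.right = coprod.inr ≫ g.right) : f = g := by
  have hf : F.map f.left ≫ X.hom = coprod.inl ≫ f.right := f.w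
  have hg : F.map g.left ≫ X.hom = coprod.inl ≫ g.right := g.w
  have h' : f.left = g.left := initial.hom_ext _ _
  refine Comma.hom_ext _ _ h' (coprod.hom_ext ?_ h)
  rw [← hf, ← hg, h']

lemma IsFinPres.commaIdLeft [HasColimits 𝒜] [HasColimits ℬ]
    (hF : ∀ (J : Type v) (_ : SmallCategory J) (_ : IsFiltered J),
      Nonempty (PreservesColimitsOfShape J F)) {M : 𝒜} (hM : IsFinPres M) :
    IsFinPres (commaIdLeft F M) := by
  intro J _ _
  have := (hF J _ inferInstance).some
  have := (hM J _ inferInstance).some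
  let e : coyoneda.obj (op (_root_.commaIdLeft F M)) ≅ Comma.fst F (𝟭 ℬ) ⋙ coyoneda.obj (op M) :=
    NatIso.ofComponents (fun X ↦ Equiv.toIso
      { toFun := fun f ↦ f.left
        invFun := fun f ↦ commaIdLeftDesc f
        left_inv := fun f ↦ commaIdLeft_hom_ext rfl
        right_inv := fun f ↦ rfl })
      (fun f ↦ by ext; simp)
  exact ⟨preservesColimitsOfShape_of_natIso e.symm⟩

lemma IsFinPres.commaIdRight [HasColimits 𝒜] [HasColimits ℬ]
    (hF : ∀ (J : Type v) (_ : SmallCategory J) (_ : IsFiltered J),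
      Nonempty (PreservesColimitsOfShape J F)) {K : ℬ} (hK : IsFinPres K) :
    IsFinPres (commaIdRight F K) := by
  intro J _ _
  have := (hF J _ inferInstance).some
  have := (hK J _ inferInstance).some
  let e : coyoneda.obj (op (_root_.commaIdRight F K)) ≅ Comma.snd F (𝟭 ℬ) ⋙ coyoneda.obj (op K) :=
    NatIso.ofComponents (fun X ↦ Equiv.toIso
      { toFun := fun f ↦ coprod.inr ≫ f.right
        invFun := fun f ↦ commaIdRightDesc f
        left_inv := fun f ↦ commaIdRight_hom_ext (coprod.inr_desc _ _)
        right_inv := fun f ↦ coprod.inr_desc _ _ })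
      (fun f ↦ by ext; simp)
  exact ⟨preservesColimitsOfShape_of_natIso e.symm⟩

lemma IsFinPres.of_inGen_hom [HasColimits 𝒜] [HasColimits ℬ]
    (hF : ∀ (J : Type v) (_ : SmallCategory J) (_ : IsFiltered J),
      Nonempty (PreservesColimitsOfShape J F)) {X : Comma F (𝟭 ℬ)} (hX : IsFinPres X.left)
    (hX' : InGen X.hom) : IsFinPres X := by
  obtain ⟨K, K', hK, hK', k, a, c, sq⟩ := hX'
  let f : _root_.commaIdRight F K ⟶ _root_.commaIdLeft F X.left := commaIdRightDesc a
  let g : _root_.commaIdRight F K ⟶ _root_.commaIdRight F K' :=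
    commaIdRightDesc (k ≫ coprod.inr)
  let h : _root_.commaIdLeft F X.left ⟶ X := commaIdLeftDesc (𝟙 _)
  let i : _root_.commaIdRight F K' ⟶ X := commaIdRightDesc c
  have hf : coprod.inr ≫ f.right = a := coprod.inr_desc _ _
  have hg : coprod.inr ≫ g.right = k ≫ coprod.inr := coprod.inr_desc _ _
  have hh : h.right = X.hom := by simp [h]
  have hi : coprod.inr ≫ i.right = c := coprod.inr_desc _ _
  have hi' : F.map i.left ≫ X.hom = coprod.inl ≫ i.right := i.w
  have hfgh : f ≫ h = g ≫ i := commaIdRight_hom_ext (by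
    rw [Comma.comp_right, Comma.comp_right, reassoc_of% hf, reassoc_of% hg, hi, hh, sq.w])
  have : IsIso g.left := by
    rw [show g.left = 𝟙 (⊥_ 𝒜) from initial.hom_ext _ _]
    infer_instance
  have : IsIso h.left := inferInstanceAs (IsIso (𝟙 X.left))
  refine .of_isPushout (f := f) (g := g) (h := h) (i := i)
    (isPushout_comma_id (.of_vert_isIso ⟨initial.hom_ext _ _⟩)
      (congr_arg CommaMorphism.right hfgh) ?_ ?_)
    (.commaIdRight hF hK) (.commaIdLeft hF hX) (.commaIdRight hF hK')
  · intro N b y z e₁ e₂ e₃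
    have e₁' : a ≫ y = k ≫ coprod.inr ≫ z := by
      rw [← reassoc_of% hg, ← e₁, reassoc_of% hf]
    have e₂' : b = y := by simpa [h] using e₂
    subst e₂'
    refine ⟨sq.desc b (coprod.inr ≫ z) e₁', sq.inl_desc _ _ _, ?_, coprod.hom_ext ?_ ?_⟩
    · rw [hh, sq.inl_desc]
    · rw [← reassoc_of% hi', sq.inl_desc, e₃]
    · rw [reassoc_of% hi, sq.inr_desc]
  · intro N d d' e₁ e₂ e₃
    refine sq.hom_ext e₁ ?_
    simp only [← hi, Category.assoc, e₃]

end CommaFinPres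

section CommaGenerator

variable {𝒜 : Type u} {ℬ : Type w} [Category.{v} 𝒜] [Category.{v} ℬ] (F : 𝒜 ⥤ ℬ)
  [HasInitial 𝒜] [HasBinaryCoproducts ℬ]

/-- The property of objects of `F ↓ ℬ` consisting of the objects `commaIdLeft F M` and
`commaIdRight F K` for `M` and `K` in given properties of objects of `𝒜` and `ℬ`. -/
abbrev commaIdGenerator (P : ObjectProperty 𝒜) (Q : ObjectProperty ℬ) :
    ObjectProperty (Comma F (𝟭 ℬ)) :=
  .ofObj (Sum.elim (fun M : Subtype P ↦ commaIdLeft F M.1)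
    (fun K : Subtype Q ↦ commaIdRight F K.1))

variable {P : ObjectProperty 𝒜} {Q : ObjectProperty ℬ}

lemma commaIdGenerator_le_iff {R : ObjectProperty (Comma F (𝟭 ℬ))} :
    commaIdGenerator F P Q ≤ R ↔
      (∀ M, P M → R (commaIdLeft F M)) ∧ (∀ K, Q K → R (commaIdRight F K)) := by
  refine ⟨fun h ↦ ⟨fun M hM ↦ h _ (.mk (Sum.inl (⟨M, hM⟩ : Subtype P))),
    fun K hK ↦ h _ (.mk (Sum.inr (⟨K, hK⟩ : Subtype Q)))⟩, ?_⟩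
  rintro ⟨h₁, h₂⟩ _ ⟨M | K⟩
  exacts [h₁ _ M.2, h₂ _ K.2]

lemma isStrongGenerator_commaIdGenerator (hP : P.IsStrongGenerator) (hQ : Q.IsStrongGenerator) :
    (commaIdGenerator F P Q).IsStrongGenerator := by
  rw [ObjectProperty.isStrongGenerator_iff] at hP hQ ⊢
  obtain ⟨hP, hP'⟩ := hP
  obtain ⟨hQ, hQ'⟩ := hQ
  obtain ⟨h₁, h₂⟩ := (commaIdGenerator_le_iff F (P := P) (Q := Q)).1 le_rfl
  refine ⟨fun X Y f g h ↦ Comma.hom_ext _ _ (hP _ _ fun M hM m ↦ ?_)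
    (hQ _ _ fun K hK k ↦ ?_), fun X Y i _ h ↦ ?_⟩
  · exact congr_arg CommaMorphism.left (h _ (h₁ M hM) (commaIdLeftDesc m))
  · simpa using coprod.inr ≫= congr_arg CommaMorphism.right (h _ (h₂ K hK) (commaIdRightDesc k))
  · have : Mono i.left := ⟨fun a b e ↦ hP _ _ fun M hM m ↦ by
      have : commaIdLeftDesc (F := F) (m ≫ a) = commaIdLeftDesc (m ≫ b) := by
        rw [← cancel_mono i]
        exact commaIdLeft_hom_ext (by simp [e])
      exact congr_arg CommaMorphism.left this⟩
    have : Mono i.right := ⟨fun a b e ↦ hQ _ _ fun K hK k ↦ by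
      have : commaIdRightDesc (F := F) (k ≫ a) = commaIdRightDesc (k ≫ b) := by
        rw [← cancel_mono i]
        exact commaIdRight_hom_ext (by simp [e])
      simpa using coprod.inr ≫= congr_arg CommaMorphism.right this⟩
    have : IsIso i.left := hP' _ fun M hM m ↦ by
      obtain ⟨l, hl⟩ := h _ (h₁ M hM) (commaIdLeftDesc m)
      exact ⟨l.left, congr_arg CommaMorphism.left hl⟩
    have : IsIso i.right := hQ' _ fun K hK k ↦ by
      obtain ⟨l, hl⟩ := h _ (h₂ K hK) (commaIdRightDesc k)
      exact ⟨coprod.inr ≫ l.right, by simpa using coprod.inr ≫= congr_arg CommaMorphism.right hl⟩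
    exact ((Comma.isoMk (asIso i.left) (asIso i.right) i.w).isIso_hom :)

end CommaGenerator

section CommaClosure

variable {𝒜 : Type u} {ℬ : Type w} [Category.{v} 𝒜] [Category.{v} ℬ] (F : 𝒜 ⥤ ℬ)

/-- The objects `f : F.obj M ⟶ B` of `F ↓ ℬ` with `M` finitely presented and `f` a pushout of a
morphism between finitely presented objects. -/
def commaGen : ObjectProperty (Comma F (𝟭 ℬ)) := fun X ↦ IsFinPres X.left ∧ InGen X.hom

variable {F}

instance : (commaGen F).IsClosedUnderIsomorphisms where
  of_iso e := fun ⟨h, h'⟩ ↦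
    ⟨h.of_iso ((Comma.fst _ _).mapIso e),
      h'.of_isPushout (f := F.map e.hom.left) (i := e.hom.right) (.of_horiz_isIso ⟨e.hom.w⟩)⟩

lemma commaGen_commaIdLeft [HasInitial ℬ] {M : 𝒜} (hM : IsFinPres M) :
    commaGen F (commaIdLeft F M) :=
  ⟨hM, .id _⟩

lemma commaGen_commaIdRight [HasInitial 𝒜] [HasInitial ℬ] [HasBinaryCoproducts ℬ] {K : ℬ}
    (hK : IsFinPres K) : commaGen F (commaIdRight F K) := by
  refine ⟨.initial, ⊥_ ℬ, K, .initial, hK, initial.to _, initial.to _, coprod.inr,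
    ⟨⟨initial.hom_ext _ _⟩, ⟨PushoutCocone.IsColimit.mk _ (fun s ↦ coprod.desc s.inl s.inr)
      (fun s ↦ coprod.inl_desc _ _) (fun s ↦ coprod.inr_desc _ _) fun s m h₁ h₂ ↦ ?_⟩⟩⟩
  apply coprod.hom_ext
  · rw [coprod.inl_desc]; exact h₁
  · rw [coprod.inr_desc]; exact h₂

/-- `commaIdLeft F (⊥_ 𝒜)` is an initial object of `F ↓ ℬ`. -/
noncomputable def isInitialCommaIdLeft [HasInitial 𝒜] : IsInitial (commaIdLeft F (⊥_ 𝒜)) :=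
  .ofUniqueHom (fun _ ↦ commaIdLeftDesc (initial.to _))
    (fun _ _ ↦ commaIdLeft_hom_ext (initial.hom_ext _ _))

lemma commaGen.exists_isPushout [IsLFP 𝒜] [IsLFP ℬ] {X Y Z : Comma F (𝟭 ℬ)} (f : X ⟶ Y) (g : X ⟶ Z)
    (hX : commaGen F X) (hY : commaGen F Y) (hZ : commaGen F Z) :
    ∃ (W : Comma F (𝟭 ℬ)) (h : Y ⟶ W) (i : Z ⟶ W), IsPushout f g h i ∧ commaGen F W := by
  obtain ⟨hX, K, K', hK, hK', k, a, c, sq⟩ := hX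
  obtain ⟨hY, hY'⟩ := hY
  obtain ⟨hZ, hZ'⟩ := hZ
  have p₀ := IsPushout.of_hasPushout f.left g.left
  have p₁ := IsPushout.of_hasPushout (F.map (pushout.inl f.left g.left)) Y.hom
  set u₁ := pushout.inl (F.map (pushout.inl f.left g.left)) Y.hom
  set v₁ : Y.right ⟶ _ := pushout.inr (F.map (pushout.inl f.left g.left)) Y.hom
  have p₂ := IsPushout.of_hasPushout (F.map (pushout.inr f.left g.left) ≫ u₁) Z.hom
  set u₂ := pushout.inl (F.map (pushout.inr f.left g.left) ≫ u₁) Z.hom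
  set v₂ : Z.right ⟶ _ := pushout.inr (F.map (pushout.inr f.left g.left) ≫ u₁) Z.hom
  have hf : F.map f.left ≫ Y.hom = X.hom ≫ f.right := f.w
  have hg : F.map g.left ≫ Z.hom = X.hom ≫ g.right := g.w
  let b₁ := c ≫ f.right ≫ v₁ ≫ u₂
  let b₂ := c ≫ g.right ≫ v₂
  have hπ : f.right ≫ v₁ ≫ u₂ ≫ coequalizer.π b₁ b₂ = g.right ≫ v₂ ≫ coequalizer.π b₁ b₂ := by
    apply sq.hom_ext
    · rw [← reassoc_of% hf, ← reassoc_of% hg, ← p₁.w_assoc, ← p₂.w_assoc, Category.assoc,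
        ← F.map_comp_assoc, ← F.map_comp_assoc, p₀.w]
    · simpa [b₁, b₂] using coequalizer.condition b₁ b₂
  let W : Comma F (𝟭 ℬ) :=
    { left := pushout f.left g.left
      right := coequalizer b₁ b₂
      hom := (u₁ ≫ u₂) ≫ coequalizer.π b₁ b₂ }
  let h : Y ⟶ W :=
    { left := pushout.inl _ _
      right := v₁ ≫ u₂ ≫ coequalizer.π b₁ b₂
      w := by simp [W, p₁.w_assoc] }
  let i : Z ⟶ W :=
    { left := pushout.inr _ _
      right := v₂ ≫ coequalizer.π b₁ b₂
      w := by simpa [W] using p₂.w_assoc (coequalizer.π b₁ b₂) }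
  refine ⟨W, h, i, isPushout_comma_id p₀ (by simpa [h, i] using hπ) ?_ ?_,
    .of_isPushout p₀ hX hY hZ, ((hY'.of_isPushout p₁).comp
      (hZ'.of_isPushout p₂)).comp_coequalizer hK' b₁ b₂⟩
  · intro N b y z e₁ e₂ e₃
    let d₁ := p₁.desc b y e₂
    have hd₁ : u₁ ≫ d₁ = b := p₁.inl_desc _ _ _
    have hd₁' : v₁ ≫ d₁ = y := p₁.inr_desc _ _ _
    let d₂ := p₂.desc d₁ z (by rw [Category.assoc, hd₁, e₃])
    have hd₂ : u₂ ≫ d₂ = d₁ := p₂.inl_desc _ _ _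
    have hd₂' : v₂ ≫ d₂ = z := p₂.inr_desc _ _ _
    refine ⟨coequalizer.desc d₂ ?_, ?_, ?_, ?_⟩
    · simp only [b₁, b₂, Category.assoc, hd₂, hd₂', hd₁', e₁]
    · simp [W, hd₂, hd₁]
    · simp [h, hd₂, hd₁']
    · simp [i, hd₂']
  · intro N d d' e₁ e₂ e₃
    refine coequalizer.hom_ext (p₂.hom_ext (p₁.hom_ext ?_ ?_) ?_)
    · simpa [W] using e₁
    · simpa [h] using e₂
    · simpa [i] using e₃

end CommaClosure

/-- For a morphism of LFP categories `F* ⊣ F_* : 𝒜 ⥤ ℬ`, the comma category `F_*↓ℬ` is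
locally finitely presentable, and its finitely presented objects are exactly those
`(M, B, f : F_*(M) ⟶ B)` with `M` finitely presented in `𝒜` and `f` a pushout of a
morphism between finitely presented objects of `ℬ`. -/
theorem stmt18 {𝒜 : Type u} {ℬ : Type w} [Category.{v} 𝒜] [Category.{v} ℬ]
    [IsLFP 𝒜] [IsLFP ℬ] (Fst : 𝒜 ⥤ ℬ) (Fup : ℬ ⥤ 𝒜) (adj : Fup ⊣ Fst)
    (hcont : Nonempty (PreservesLimits Fst))
    (hfin : ∀ (J : Type v) (_ : SmallCategory J) (_ : IsFiltered J),
      Nonempty (PreservesColimitsOfShape J Fst)) :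
    IsLFP (Comma Fst (𝟭 ℬ)) ∧
      ∀ X : Comma Fst (𝟭 ℬ), IsFinPres X ↔ (IsFinPres X.left ∧ InGen X.hom) := by
  have := hasColimits_comma_id Fst
  have := hasFiniteColimits_of_hasColimits (Comma Fst (𝟭 ℬ))
  obtain ⟨P, _, hP⟩ := IsLFP.exists_small_generator 𝒜
  obtain ⟨Q, _, hQ⟩ := IsLFP.exists_small_generator ℬ
  have hP' (M : 𝒜) (hM : P M) : IsFinPres M :=
    (isFinPres_iff M).2 (hP.le_isCardinalPresentable M hM)
  have hQ' (K : ℬ) (hK : Q K) : IsFinPres K :=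
    (isFinPres_iff K).2 (hQ.le_isCardinalPresentable K hK)
  have hG := isStrongGenerator_commaIdGenerator Fst hP.isStrongGenerator hQ.isStrongGenerator
  have hG' : commaIdGenerator Fst P Q ≤
      isCardinalPresentable (Comma Fst (𝟭 ℬ)) (ℵ₀ : Cardinal.{v}) :=
    (commaIdGenerator_le_iff Fst).2
      ⟨fun M hM ↦ (isFinPres_iff _).1 (.commaIdLeft hfin (hP' M hM)),
        fun K hK ↦ (isFinPres_iff _).1 (.commaIdRight hfin (hQ' K hK))⟩
  have : IsCardinalLocallyPresentable (Comma Fst (𝟭 ℬ)) (ℵ₀ : Cardinal.{v}) :=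
    (IsCardinalLocallyPresentable.iff_exists_isStrongGenerator _ _).2
      ⟨_, inferInstance, hG, hG'⟩
  refine ⟨.of_isCardinalLocallyPresentable, fun X ↦ ⟨fun hX ↦ ?_, fun ⟨h, h'⟩ ↦
    .of_inGen_hom hfin h h'⟩⟩
  have hle : (commaIdGenerator Fst P Q).colimitsCardinalClosure (ℵ₀ : Cardinal.{v}) ≤
      commaGen Fst :=
    ObjectProperty.colimitsCardinalClosure_le _ _
      (fun J _ hJ ↦ by
        have := (hasCardinalLT_aleph0_iff _).1 hJ
        exact isClosedUnderColimitsOfShape_of_initial_of_pushout _ isInitialCommaIdLeft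
          (commaGen_commaIdLeft .initial) commaGen.exists_isPushout J)
      ((commaIdGenerator_le_iff Fst).2
        ⟨fun M hM ↦ commaGen_commaIdLeft (hP' M hM), fun K hK ↦ commaGen_commaIdRight (hQ' K hK)⟩)
  rw [← IsStrongGenerator.colimitsCardinalClosure_eq_isCardinalPresentable hG hG'] at hle
  exact hle X ((isFinPres_iff X).1 hX)
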